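/- arXiv:1511.06637 — 6 statements merged into one kernel-verified Lean document; each statement's English description precedes it below -/
import Mathlib

section
/- Let V and K be finite-dimensional complex vector spaces, let C : V → End(K) be a ℂ-linear map whose values pairwise commute, and let ζ ∈ K be such that the map I : V → K, I(X) = -C_X(ζ), is bijective. Then there exists a unique structure of a commutative, associative, unital ℂ-algebra (V, ∘, e) on V such that C_{X∘Y} = -C_X C_Y for all X, Y ∈ V and C_e = -id_K. (This is the pointwise algebraic core of the statement that a (TEP)-structure with the unfolding condition induces an F-manifold structure, whose multiplication and unit are independent of the choice of primitive section ζ.) -/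
/-- The pointwise algebraic core of the statement that a (TEP)-structure with the
unfolding condition induces an F-manifold structure: given a ℂ-linear map
`C : V → End(K)` with pairwise commuting values and a primitive vector `ζ` for which
`I : X ↦ -C_X ζ` is bijective, there is a unique commutative, associative, unital
ℂ-bilinear multiplication `∘` with unit `e` on `V` such that `C_{X ∘ Y} = -C_X C_Y`
and `C_e = -id`. -/
theorem unique_F_algebra_structure
    (V K : Type*) [AddCommGroup V] [Module ℂ V] [FiniteDimensional ℂ V]
    [AddCommGroup K] [Module ℂ K] [FiniteDimensional ℂ K]
    (C : V →ₗ[ℂ] Module.End ℂ K)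
    (hcomm : ∀ X Y : V, Commute (C X) (C Y))
    (ζ : K) (hunf : Function.Bijective (fun X : V => -(C X ζ))) :
    ∃! p : (V → V → V) × V,
      (∀ (a : ℂ) (X Y : V), p.1 (a • X) Y = a • p.1 X Y) ∧
      (∀ X Y Z : V, p.1 (X + Y) Z = p.1 X Z + p.1 Y Z) ∧
      (∀ X Y : V, p.1 X Y = p.1 Y X) ∧
      (∀ X Y Z : V, p.1 (p.1 X Y) Z = p.1 X (p.1 Y Z)) ∧
      (∀ X : V, p.1 p.2 X = X) ∧
      (∀ X Y : V, C (p.1 X Y) = -(C X * C Y)) ∧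
      C p.2 = -1 := by
  have key : ∀ A B : Module.End ℂ K, (∀ Z, Commute A (C Z)) → (∀ Z, Commute B (C Z)) →
      A ζ = B ζ → A = B := by
    intro A B hA hB h
    ext k
    obtain ⟨Z, hZ⟩ := hunf.2 k
    have h1 : A (C Z ζ) = C Z (A ζ) := LinearMap.congr_fun (hA Z).eq ζ
    have h2 : B (C Z ζ) = C Z (B ζ) := LinearMap.congr_fun (hB Z).eq ζ
    simp only at hZ
    rw [← hZ, map_neg, map_neg, h1, h2, h]
  have inj : ∀ X Y : V, C X = C Y → X = Y := by
    intro X Y h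
    apply hunf.1
    simp only [h]
  have hm : ∀ X Y : V, ∃ W : V, C W = -(C X * C Y) := by
    intro X Y
    obtain ⟨W, hW⟩ := hunf.2 (C X (C Y ζ))
    refine ⟨W, key _ _ (fun Z => hcomm W Z) (fun Z => ?_) ?_⟩
    · exact ((hcomm X Z).mul_left (hcomm Y Z)).neg_left
    · simp only at hW
      rw [LinearMap.neg_apply, Module.End.mul_apply, ← hW, neg_neg]
  have he : ∃ e : V, C e = -1 := by
    obtain ⟨W, hW⟩ := hunf.2 ζ
    refine ⟨W, key _ _ (fun Z => hcomm W Z) (fun Z => (Commute.one_left _).neg_left) ?_⟩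
    simp only at hW
    rw [LinearMap.neg_apply, Module.End.one_apply]
    exact neg_eq_iff_eq_neg.mp hW
  choose m hm using hm
  obtain ⟨e, he⟩ := he
  refine ⟨(m, e), ⟨?_, ?_, ?_, ?_, ?_, hm, he⟩, ?_⟩
  · intro a X Y
    apply inj
    simp [hm]
  · intro X Y Z
    apply inj
    simp only [hm, map_add, add_mul, neg_add]
  · intro X Y
    apply inj
    simp only [hm, (hcomm X Y).eq]
  · intro X Y Z
    apply inj
    simp only [hm, neg_mul, mul_neg, mul_assoc]
  · intro X
    apply inj
    simp [hm, he]
  · rintro ⟨m', e'⟩ ⟨-, -, -, -, -, h1, h2⟩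
    refine Prod.ext ?_ ?_
    · funext X Y
      exact inj _ _ ((h1 X Y).trans (hm X Y).symm)
    · exact inj _ _ (h2.trans he.symm)
end

section
/- Let V and K be finite-dimensional complex vector spaces, let C : V → End(K) be a ℂ-linear map whose values pairwise commute, and let ζ ∈ K be such that the map I : V → K, I(X) = -C_X(ζ), is bijective. If 𝒰 ∈ End(K) commutes with C_X for every X ∈ V, then there exists a unique element E ∈ V such that C_E = -𝒰. (This is the pointwise statement that the Euler field E of the F-manifold induced by a (TEP)-structure with the unfolding condition is well defined and independent of the primitive section.) -/
/-- The pointwise statement that the Euler field `E` of the F-manifold induced by a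
(TEP)-structure with the unfolding condition is well defined and independent of the
primitive section: if `𝒰 ∈ End(K)` commutes with every `C_X`, then there is a unique
`E ∈ V` with `C_E = -𝒰`. -/
theorem unique_Euler_field
    (V K : Type*) [AddCommGroup V] [Module ℂ V] [FiniteDimensional ℂ V]
    [AddCommGroup K] [Module ℂ K] [FiniteDimensional ℂ K]
    (C : V →ₗ[ℂ] Module.End ℂ K)
    (hcomm : ∀ X Y : V, Commute (C X) (C Y))
    (ζ : K) (hunf : Function.Bijective (fun X : V => -(C X ζ)))
    (𝒰 : Module.End ℂ K) (h𝒰 : ∀ X : V, Commute (C X) 𝒰) :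
    ∃! E : V, C E = -𝒰 := by
  obtain ⟨E, hE⟩ := hunf.2 (𝒰 ζ)
  refine ⟨E, ?_, ?_⟩
  · ext k
    obtain ⟨X, rfl⟩ := hunf.2 k
    have h1 : C E (C X ζ) = C X (C E ζ) := LinearMap.congr_fun (hcomm E X).eq ζ
    have h2 : C X (𝒰 ζ) = 𝒰 (C X ζ) := LinearMap.congr_fun (h𝒰 X).eq ζ
    have h3 : C E ζ = -(𝒰 ζ) := by rw [← hE]; simp
    simp only [map_neg, LinearMap.neg_apply, h1, h3, h2]
  · intro F hF
    apply hunf.1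
    rw [hE]
    have hF' : C F = -𝒰 := hF
    simp [hF']
end

section
/- Let V and K be finite-dimensional complex vector spaces, let C : V → End(K) be a ℂ-linear map whose values pairwise commute, let ζ ∈ K be such that the map I : V → K, I(X) = -C_X(ζ), is bijective, and let ∘ be the induced commutative associative unital multiplication on V (determined by C_{X∘Y} = -C_X C_Y and C_e = -id_K). Let g be a nondegenerate symmetric ℂ-bilinear form on K such that every C_X is g-symmetric, i.e. g(C_X a, b) = g(a, C_X b) for all X ∈ V and a, b ∈ K. Then the bilinear form g^M on V defined by g^M(X, Y) := g(C_X(ζ), C_Y(ζ)) is symmetric, nondegenerate, and multiplication invariant: g^M(X∘Y, Z) = g^M(X, Y∘Z) for all X, Y, Z ∈ V. In particular (V, ∘, e, g^M) is a Frobenius algebra, so the algebra (V, ∘, e) is a Gorenstein ring. -/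
/-- Given a (pointwise) Higgs datum `C : V → End(K)` with commuting, `g`-symmetric values
and a primitive vector `ζ` (unfolding condition), with the induced commutative associative
unital multiplication `∘` (determined by `C_{X ∘ Y} = -C_X C_Y`, `C_e = -id`), the bilinear
form `g^M(X, Y) := g(C_X ζ, C_Y ζ)` on `V` is symmetric, nondegenerate and multiplication
invariant; in particular `(V, ∘, e, g^M)` is a Frobenius algebra, so `(V, ∘, e)` is a
Gorenstein ring. -/
theorem induced_metric_frobenius
    (V K : Type*) [AddCommGroup V] [Module ℂ V] [FiniteDimensional ℂ V]
    [AddCommGroup K] [Module ℂ K] [FiniteDimensional ℂ K]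
    (C : V →ₗ[ℂ] Module.End ℂ K)
    (hcomm : ∀ X Y : V, Commute (C X) (C Y))
    (ζ : K) (hunf : Function.Bijective (fun X : V => -(C X ζ)))
    (g : K →ₗ[ℂ] K →ₗ[ℂ] ℂ)
    (hgsymm : ∀ a b : K, g a b = g b a)
    (hgnd : ∀ a : K, (∀ b : K, g a b = 0) → a = 0)
    (hCg : ∀ (X : V) (a b : K), g (C X a) b = g a (C X b))
    (mul : V → V → V) (e : V)
    (hmulcomm : ∀ X Y : V, mul X Y = mul Y X)
    (hmulassoc : ∀ X Y Z : V, mul (mul X Y) Z = mul X (mul Y Z))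
    (hunit : ∀ X : V, mul e X = X)
    (hmulC : ∀ X Y : V, C (mul X Y) = -(C X * C Y))
    (heC : C e = -1) :
    (∀ X Y : V, g (C X ζ) (C Y ζ) = g (C Y ζ) (C X ζ)) ∧
    (∀ X : V, (∀ Y : V, g (C X ζ) (C Y ζ) = 0) → X = 0) ∧
    (∀ X Y Z : V, g (C (mul X Y) ζ) (C Z ζ) = g (C X ζ) (C (mul Y Z) ζ)) := by
  refine ⟨fun X Y => hgsymm _ _, fun X h => ?_, fun X Y Z => ?_⟩
  · have h0 : C X ζ = 0 := by
      apply hgnd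
      intro b
      obtain ⟨Y, hY⟩ := hunf.2 b
      have hY' : -(C Y ζ) = b := hY
      rw [← hY', map_neg, h Y, neg_zero]
    apply hunf.1
    simp [h0]
  · have hc : C X (C Y ζ) = C Y (C X ζ) := LinearMap.congr_fun (hcomm X Y).eq ζ
    rw [hmulC, hmulC]
    simp only [LinearMap.neg_apply, Module.End.mul_apply, map_neg]
    rw [hc, hCg Y]
end

section
/- Let V and K be finite-dimensional complex vector spaces, let C : V → End(K) be a ℂ-linear map whose values pairwise commute and are all g-symmetric with respect to a nondegenerate symmetric ℂ-bilinear form g on K, and let ζ ∈ K be such that the map I : V → K, I(X) = -C_X(ζ), is bijective. Let Q ∈ End(K) be g-skew-symmetric, and let Φ : V → End(K) be any map satisfying Φ(X)(ζ) - [C_X, Q](ζ) + C_X(ζ) = 0 for all X ∈ V. Define Ψ ∈ End(K) by Ψ(s) := Φ(I^{-1}(s))(ζ). Then Q equals the g-skew-symmetric part of Ψ, i.e. Q = (1/2)(Ψ - Ψ*), where Ψ* is the g-adjoint of Ψ. (This is the pointwise algebraic content of the lemma that in a CV-structure with the unfolding condition the endomorphism 𝒬 equals the g-skew-symmetric part of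 s ↦ D_{I^{-1}(s)}(𝒰)(ζ).) -/
/-- Pointwise algebraic content of the lemma that in a CV-structure with the unfolding
condition the endomorphism `𝒬` equals the `g`-skew-symmetric part of
`s ↦ D_{I⁻¹(s)}(𝒰)(ζ)`: if `Q` is `g`-skew-symmetric and `Φ : V → End(K)` satisfies
`Φ(X)(ζ) - [C_X, Q](ζ) + C_X(ζ) = 0` for all `X`, and `Ψ ∈ End(K)` is defined by
`Ψ(s) := Φ(I⁻¹(s))(ζ)` (i.e. `Ψ(I X) = Φ(X)(ζ)` for all `X`, where `I X = -C_X ζ`),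
then `Q = (1/2)(Ψ - Ψ*)` where `Ψ*` is the `g`-adjoint of `Ψ`. -/
theorem Q_eq_skew_part
    (V K : Type*) [AddCommGroup V] [Module ℂ V] [FiniteDimensional ℂ V]
    [AddCommGroup K] [Module ℂ K] [FiniteDimensional ℂ K]
    (g : K →ₗ[ℂ] K →ₗ[ℂ] ℂ)
    (hgsymm : ∀ a b : K, g a b = g b a)
    (hgnd : ∀ a : K, (∀ b : K, g a b = 0) → a = 0)
    (C : V →ₗ[ℂ] Module.End ℂ K)
    (hcomm : ∀ X Y : V, Commute (C X) (C Y))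
    (hCg : ∀ (X : V) (a b : K), g (C X a) b = g a (C X b))
    (ζ : K) (hunf : Function.Bijective (fun X : V => -(C X ζ)))
    (Q : Module.End ℂ K)
    (hQskew : ∀ a b : K, g (Q a) b = -(g a (Q b)))
    (Φ : V → Module.End ℂ K)
    (hΦ : ∀ X : V, Φ X ζ - (C X * Q - Q * C X) ζ + C X ζ = 0)
    (Ψ Ψstar : Module.End ℂ K)
    (hΨ : ∀ X : V, Ψ (-(C X ζ)) = Φ X ζ)
    (hΨstar : ∀ a b : K, g (Ψ a) b = g a (Ψstar b)) :
    Q = (1 / 2 : ℂ) • (Ψ - Ψstar) := by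
  have hval : ∀ X : V, Ψ (-(C X ζ)) = C X (Q ζ) - Q (C X ζ) - C X ζ := by
    intro X
    have h := hΦ X
    simp only [LinearMap.sub_apply, Module.End.mul_apply] at h
    rw [hΨ X, ← sub_eq_zero, ← h]
    abel
  have hτ : ∀ X Y : V, g (C X (Q ζ)) (C Y ζ) = g (C Y (Q ζ)) (C X ζ) := by
    intro X Y
    have h : C X (C Y ζ) = C Y (C X ζ) := by
      have := LinearMap.congr_fun (hcomm X Y).eq ζ
      simpa only [Module.End.mul_apply] using this
    rw [hCg, hCg, h]
  ext s
  rw [← sub_eq_zero]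
  apply hgnd
  intro t
  obtain ⟨X, rfl⟩ := hunf.2 s
  obtain ⟨Y, rfl⟩ := hunf.2 t
  have h1 : g (Ψstar (-(C X ζ))) (-(C Y ζ)) = g (Ψ (-(C Y ζ))) (-(C X ζ)) := by
    rw [hΨstar, hgsymm]
  have h2 := hτ X Y
  have h3 := hQskew (C Y ζ) (C X ζ)
  have h4 := hgsymm (C Y ζ) (Q (C X ζ))
  have h5 := hgsymm (C Y ζ) (C X ζ)
  simp only [LinearMap.sub_apply, LinearMap.smul_apply, map_sub, map_smul, smul_eq_mul]
  rw [h1, hval X, hval Y]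
  simp only [map_neg, LinearMap.neg_apply, LinearMap.sub_apply, map_sub]
  linear_combination (1 / 2 : ℂ) * (h2 + h3 - h4 + h5)
end

section
/- Let V and K be finite-dimensional complex vector spaces, let C : V → End(K) be a ℂ-linear map whose values pairwise commute and are all g-symmetric with respect to a nondegenerate symmetric ℂ-bilinear form g on K, and let ζ ∈ K be such that the map I : V → K, I(X) = -C_X(ζ), is bijective. Let Φ : V → End(K) be any map. If Q₁ and Q₂ are both g-skew-symmetric endomorphisms of K satisfying Φ(X)(ζ) - [C_X, Q_i](ζ) + C_X(ζ) = 0 for all X ∈ V (i = 1, 2), then Q₁ = Q₂. (This expresses that the operator 𝒬 of a CV-structure with the unfolding condition is uniquely determined by the remaining data.) -/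
/-- The operator `𝒬` of a CV-structure with the unfolding condition is uniquely determined
by the remaining data: if `Q₁`, `Q₂` are `g`-skew-symmetric endomorphisms of `K` each
satisfying `Φ(X)(ζ) - [C_X, Q_i](ζ) + C_X(ζ) = 0` for all `X ∈ V`, then `Q₁ = Q₂`. -/
theorem Q_unique
    (V K : Type*) [AddCommGroup V] [Module ℂ V] [FiniteDimensional ℂ V]
    [AddCommGroup K] [Module ℂ K] [FiniteDimensional ℂ K]
    (g : K →ₗ[ℂ] K →ₗ[ℂ] ℂ)
    (hgsymm : ∀ a b : K, g a b = g b a)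
    (hgnd : ∀ a : K, (∀ b : K, g a b = 0) → a = 0)
    (C : V →ₗ[ℂ] Module.End ℂ K)
    (hcomm : ∀ X Y : V, Commute (C X) (C Y))
    (hCg : ∀ (X : V) (a b : K), g (C X a) b = g a (C X b))
    (ζ : K) (hunf : Function.Bijective (fun X : V => -(C X ζ)))
    (Φ : V → Module.End ℂ K)
    (Q₁ Q₂ : Module.End ℂ K)
    (hQ₁skew : ∀ a b : K, g (Q₁ a) b = -(g a (Q₁ b)))
    (hQ₂skew : ∀ a b : K, g (Q₂ a) b = -(g a (Q₂ b)))
    (hΦ₁ : ∀ X : V, Φ X ζ - (C X * Q₁ - Q₁ * C X) ζ + C X ζ = 0)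
    (hΦ₂ : ∀ X : V, Φ X ζ - (C X * Q₂ - Q₂ * C X) ζ + C X ζ = 0) :
    Q₁ = Q₂ := by
  have hD : ∀ X : V, Q₁ (C X ζ) - Q₂ (C X ζ) = C X (Q₁ ζ - Q₂ ζ) := by
    intro X
    have h1 := hΦ₁ X
    have h2 := hΦ₂ X
    simp only [LinearMap.sub_apply, Module.End.mul_apply] at h1 h2
    rw [map_sub]
    have h3 := h1.trans h2.symm
    have h4 := sub_eq_zero.mpr h3
    rw [← sub_eq_zero, ← h4]
    abel
  obtain ⟨Z, hZ⟩ := hunf.2 (-(Q₁ ζ - Q₂ ζ))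
  have hZ' : C Z ζ = Q₁ ζ - Q₂ ζ := neg_injective hZ
  have hDC : ∀ a : K, Q₁ a - Q₂ a = C Z a := by
    intro a
    obtain ⟨X, hX⟩ := hunf.2 (-a)
    have hX' : C X ζ = a := neg_injective hX
    rw [← hX', hD X, ← hZ']
    have := congrArg (fun f : Module.End ℂ K => f ζ) (hcomm X Z).eq
    simpa only [Module.End.mul_apply] using this
  ext a
  rw [← sub_eq_zero]
  apply hgnd
  intro b
  have e1 : g (Q₁ a - Q₂ a) b = g a (Q₁ b - Q₂ b) := by
    rw [hDC a, hDC b, hCg]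
  have e2 : g (Q₁ a - Q₂ a) b = - g a (Q₁ b - Q₂ b) := by
    simp only [map_sub, LinearMap.sub_apply, hQ₁skew a b, hQ₂skew a b]
    ring
  linear_combination (e1 + e2) / 2
end

section
/- For every n ≥ 1 there exists a real constant k₀ > 0 such that every n×n complex matrix A which is symmetric (Aᵀ = A), nilpotent, and normalized by tr(A·Aᴴ) = 1 satisfies tr([A, Aᴴ]·[A, Aᴴ]ᴴ) ≥ k₀ (this trace is automatically a nonnegative real number, being the squared Frobenius norm of [A, Aᴴ]). Equivalently, the function ρ(A) = -tr([A, Aᴴ]·[A, Aᴴ]ᴴ) / tr(A·Aᴴ)² is bounded from above by the negative number -k₀ on the set of symmetric nilpotent matrices of Frobenius norm 1. -/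
open Matrix ComplexOrder


lemma aux_tr_re {n : ℕ} (B : Matrix (Fin n) (Fin n) ℂ) :
    (B * Bᴴ).trace = ((∑ i, ∑ j, ‖B i j‖ ^ 2 : ℝ) : ℂ) := by
  simp [Matrix.trace, Matrix.mul_apply, Complex.mul_conj, Complex.normSq_eq_norm_sq]

lemma aux_pow {n : ℕ} (A : Matrix (Fin n) (Fin n) ℂ) (h : IsNilpotent A) : A ^ n = 0 := by
  have h1 := (Matrix.isNilpotent_charpoly_sub_pow_of_isNilpotent h).eq_zero
  have h2 := Matrix.aeval_self_charpoly A
  rw [sub_eq_zero.mp h1] at h2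
  simpa using h2

lemma aux_compact (n : ℕ) :
    IsCompact {A : Matrix (Fin n) (Fin n) ℂ | A ^ n = 0 ∧ (A * Aᴴ).trace = 1} := by
  have hK : IsCompact (Set.pi Set.univ fun _ : Fin n => Set.pi Set.univ fun _ : Fin n =>
      Metric.closedBall (0 : ℂ) 1) :=
    isCompact_univ_pi fun _ => isCompact_univ_pi fun _ => isCompact_closedBall _ _
  refine IsCompact.of_isClosed_subset (X := Matrix (Fin n) (Fin n) ℂ) hK ?_ ?_
  · refine IsClosed.inter ?_ ?_
    · exact isClosed_eq (continuous_id.pow n) continuous_const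
    · refine isClosed_eq ?_ continuous_const
      exact (continuous_id.matrix_mul continuous_id.matrix_conjTranspose).matrix_trace
  · rintro A ⟨-, h⟩ i - j -
    rw [aux_tr_re] at h
    have h' : (∑ i, ∑ j, ‖A i j‖ ^ 2 : ℝ) = 1 := by exact_mod_cast h
    have h1 : ‖A i j‖ ^ 2 ≤ ∑ j, ‖A i j‖ ^ 2 :=
      Finset.single_le_sum (f := fun j => ‖A i j‖ ^ 2) (fun _ _ => by positivity)
        (Finset.mem_univ j)
    have h2 : ∑ j, ‖A i j‖ ^ 2 ≤ ∑ i, ∑ j, ‖A i j‖ ^ 2 :=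
      Finset.single_le_sum (f := fun i => ∑ j, ‖A i j‖ ^ 2) (fun _ _ => by positivity)
        (Finset.mem_univ i)
    rw [mem_closedBall_zero_iff]
    nlinarith [norm_nonneg (A i j)]

lemma aux_pos {n : ℕ} (A : Matrix (Fin n) (Fin n) ℂ) (h : IsNilpotent A)
    (h1 : (A * Aᴴ).trace = 1) :
    0 < ∑ i, ∑ j, ‖(A * Aᴴ - Aᴴ * A) i j‖ ^ 2 := by
  refine lt_of_le_of_ne (by positivity) fun h0 => ?_
  have h2 := aux_tr_re (A * Aᴴ - Aᴴ * A)
  rw [← h0, Complex.ofReal_zero, Matrix.trace_mul_conjTranspose_self_eq_zero_iff] at h2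
  have hc : Commute A Aᴴ := sub_eq_zero.mp h2
  have h3 := (Matrix.isNilpotent_trace_of_isNilpotent (hc.isNilpotent_mul_right h)).eq_zero
  rw [h1] at h3
  exact one_ne_zero h3

/-- For every `n ≥ 1` there is `k₀ > 0` such that every symmetric nilpotent `n × n`
complex matrix `A` normalized by `tr (A * Aᴴ) = 1` satisfies
`tr ([A, Aᴴ] * [A, Aᴴ]ᴴ) ≥ k₀` (this trace, the squared Frobenius norm of `[A, Aᴴ]`,
is automatically a nonnegative real number). Equivalently, the function
`ρ(A) = -tr ([A, Aᴴ] * [A, Aᴴ]ᴴ) / tr (A * Aᴴ)²` is bounded above by `-k₀` on the set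
of symmetric nilpotent matrices of Frobenius norm `1`. -/
theorem exists_uniform_bound_on_normalized_symmetric_nilpotent
    (n : ℕ) (hn : 1 ≤ n) :
    ∃ k₀ : ℝ, 0 < k₀ ∧
      ∀ A : Matrix (Fin n) (Fin n) ℂ,
        Aᵀ = A → IsNilpotent A → (A * Aᴴ).trace = 1 →
        (k₀ : ℂ) ≤ ((A * Aᴴ - Aᴴ * A) * (A * Aᴴ - Aᴴ * A)ᴴ).trace := by
  have hcont : Continuous fun A : Matrix (Fin n) (Fin n) ℂ =>
      ∑ i, ∑ j, ‖(A * Aᴴ - Aᴴ * A) i j‖ ^ 2 := by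
    have hB : Continuous fun A : Matrix (Fin n) (Fin n) ℂ => A * Aᴴ - Aᴴ * A :=
      (continuous_id.matrix_mul continuous_id.matrix_conjTranspose).sub
        (continuous_id.matrix_conjTranspose.matrix_mul continuous_id)
    exact continuous_finsetSum _ fun i _ => continuous_finsetSum _ fun j _ =>
      (hB.matrix_elem i j).norm.pow 2
  rcases Set.eq_empty_or_nonempty
    {A : Matrix (Fin n) (Fin n) ℂ | A ^ n = 0 ∧ (A * Aᴴ).trace = 1} with he | hne
  · refine ⟨1, one_pos, fun A _ hA h1 => ?_⟩
    exact (Set.eq_empty_iff_forall_notMem.mp he A ⟨aux_pow A hA, h1⟩).elim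
  · obtain ⟨A₀, ⟨h0, h0'⟩, hmin⟩ := (aux_compact n).exists_isMinOn hne hcont.continuousOn
    refine ⟨_, aux_pos A₀ ⟨n, h0⟩ h0', fun A _ hA h1 => ?_⟩
    rw [aux_tr_re]
    exact_mod_cast hmin ⟨aux_pow A hA, h1⟩
end
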